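/- The linear map F → A × V* given by (d,(u,α)) ↦ (p_A(d), α) is a linear isomorphism; in particular, for each a ∈ A and α ∈ V* there is exactly one element of F whose 𝔻-component has A-part a and whose V*-component is α. (This underlies the parametrization of F in Section 4.2 of the paper.) -/

import Mathlib

/-- The symmetric bilinear pairing on `E = 𝔻 × (V × V*)`:
`⟪(d₁,(u₁,α₁)),(d₂,(u₂,α₂))⟫ = ⟨d₁,d₂⟩ + (1/2)(α₁(u₂) + α₂(u₁))`. -/
noncomputable def pairE {D V : Type*} [AddCommGroup D] [Module ℝ D] [AddCommGroup V] [Module ℝ V]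
    (B : LinearMap.BilinForm ℝ D) (p q : D × V × Module.Dual ℝ V) : ℝ :=
  B p.1 q.1 + (1 / 2) * (p.2.2 q.2.1 + q.2.2 p.2.1)

/-- A subspace `W` of the dual of a finite-dimensional space that separates points is everything. -/
theorem Module.Dual.eq_top_of_separating {K V : Type*} [Field K] [AddCommGroup V] [Module K V]
    [FiniteDimensional K V] (W : Submodule K (Module.Dual K V))
    (h : ∀ u : V, (∀ α ∈ W, α u = 0) → u = 0) : W = ⊤ := by
  have hbot : W.dualCoannihilator = ⊥ :=
    (Submodule.eq_bot_iff _).2 fun u hu => h u ((Submodule.mem_dualCoannihilator u).1 hu)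
  rw [← Subspace.dualCoannihilator_dualAnnihilator_eq (W := W), hbot,
    Submodule.dualAnnihilator_bot]

theorem stmt
    {D V : Type*} [AddCommGroup D] [Module ℝ D] [FiniteDimensional ℝ D]
    [AddCommGroup V] [Module ℝ V] [FiniteDimensional ℝ V]
    (B : LinearMap.BilinForm ℝ D) (hBsymm : B.IsSymm) (hBnd : B.Nondegenerate)
    (A : Submodule ℝ D)
    -- `A = A^⊥` (A is Lagrangian in 𝔻)
    (hA : (A : Set D) = {d : D | ∀ a ∈ A, B d a = 0})
    (F : Submodule ℝ (D × V × Module.Dual ℝ V))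
    -- `F = F^⊥` with respect to the pairing `pairE B` (F is Lagrangian in E)
    (hF : (F : Set (D × V × Module.Dual ℝ V)) =
      {e : D × V × Module.Dual ℝ V | ∀ f ∈ F, pairE B e f = 0})
    -- (i) `F` intersects `{0} × (V × {0})` trivially
    (hFi : ∀ u : V, ((0 : D), u, (0 : Module.Dual ℝ V)) ∈ F → u = 0)
    -- (ii) the image of `F ∩ (𝔻 × (V × {0}))` under the projection `E → 𝔻` equals `A`
    (hFii : ∀ d : D, d ∈ A ↔ ∃ u : V, (d, u, (0 : Module.Dual ℝ V)) ∈ F)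
    -- `B₀` is an isotropic complement of `A` in `𝔻`
    (B₀ : Submodule ℝ D) (hB₀iso : ∀ b ∈ B₀, ∀ b' ∈ B₀, B b b' = 0)
    (hcompl : IsCompl A B₀)
    -- `pA : 𝔻 → A` is the projection with kernel `B₀`
    (pA : D →ₗ[ℝ] A) (hpA1 : ∀ a : A, pA (a : D) = a) (hpA2 : ∀ b ∈ B₀, pA b = 0)
    :
    -- the map `F → A × V*`, `(d,(u,α)) ↦ (p_A d, α)` is injective …
    (∀ e₁ ∈ F, ∀ e₂ ∈ F, pA e₁.1 = pA e₂.1 → e₁.2.2 = e₂.2.2 → e₁ = e₂) ∧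
    -- … and surjective
    (∀ (a : A) (α : Module.Dual ℝ V), ∃ e ∈ F, pA e.1 = a ∧ e.2.2 = α) := by
  constructor
  · rintro ⟨d₁, u₁, α₁⟩ h₁ ⟨d₂, u₂, α₂⟩ h₂ hp hα
    dsimp only at hp hα
    subst hα
    have hsub := F.sub_mem h₁ h₂
    simp only [Prod.mk_sub_mk, sub_self] at hsub
    have hmem : d₁ - d₂ ∈ A := (hFii _).2 ⟨_, hsub⟩
    have hd : d₁ - d₂ = 0 := by
      have h := hpA1 ⟨d₁ - d₂, hmem⟩
      rw [map_sub, hp, sub_self] at h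
      exact congrArg Subtype.val h.symm
    rw [hd] at hsub
    rw [sub_eq_zero.1 hd, sub_eq_zero.1 (hFi _ hsub)]
  · intro a α
    have htop : F.map (LinearMap.snd ℝ V (Module.Dual ℝ V) ∘ₗ LinearMap.snd ℝ D _) = ⊤ := by
      refine Module.Dual.eq_top_of_separating _ fun u hu => hFi u ?_
      rw [← SetLike.mem_coe, hF]
      intro f hf
      have hfu : f.2.2 u = 0 := hu _ (Submodule.mem_map_of_mem hf)
      simp [pairE, hfu]
    obtain ⟨e, he, rfl⟩ : α ∈ F.map (LinearMap.snd ℝ V (Module.Dual ℝ V) ∘ₗ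
        LinearMap.snd ℝ D _) := htop ▸ Submodule.mem_top
    obtain ⟨u, hu⟩ := (hFii _).1 (a - pA e.1).2
    exact ⟨_, F.add_mem he hu, by simp only [Prod.fst_add, map_add, hpA1, add_sub_cancel],
      by simp⟩
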